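/- Suppose λ_p := sup σ(H^p) > 0 and there exists an eigenfunction v_p ∈ ℓ²(ℤ^{pd}) with H^p v_p = λ_p v_p. Then v_p ∈ ℓ¹(ℤ^{pd}), i.e. Σ_{x ∈ ℤ^{pd}} |v_p(x)| < ∞. -/

import Mathlib

open Filter Topology

/-- The quadratic form of a symmetric operator on a real Hilbert space is bounded by the supremum
of its spectrum. -/
theorem inner_apply_self_le_sSup_spectrum {E : Type*} [NormedAddCommGroup E]
    [InnerProductSpace ℝ E] [CompleteSpace E] (H : E →L[ℝ] E)
    (hH : ∀ f g, inner ℝ (H f) g = inner ℝ f (H g)) (f : E) :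
    inner ℝ (H f) f ≤ sSup (spectrum ℝ H) * ‖f‖ ^ 2 := by
  rcases subsingleton_or_nontrivial E with _ | _
  · simp [Subsingleton.elim f 0]
  set T : E →L[ℝ] E := algebraMap ℝ (E →L[ℝ] E) ‖H‖ + H with hT
  have hTapp (x : E) : inner ℝ (T x) x = ‖H‖ * ‖x‖ ^ 2 + inner ℝ (H x) x := by
    simp [hT, inner_add_left, Algebra.algebraMap_eq_smul_one, inner_smul_left]
  have hTsymm : (T : E →ₗ[ℝ] E).IsSymmetric := by
    intro x y
    have := hH x y
    simp [hT, inner_add_left, inner_add_right, Algebra.algebraMap_eq_smul_one, inner_smul_left,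
      inner_smul_right, this]
  have hTnonneg (x : E) : 0 ≤ T.rayleighQuotient x := by
    rw [ContinuousLinearMap.rayleighQuotient, ContinuousLinearMap.reApplyInnerSelf_apply]
    refine div_nonneg ?_ (by positivity)
    have h1 := abs_real_inner_le_norm (H x) x
    have h2 := H.le_opNorm x
    have h3 := neg_le_of_abs_le h1
    have h4 := hTapp x
    simp only [RCLike.re_to_real]
    nlinarith [norm_nonneg x]
  have hmem : ‖T‖ ∈ spectrum ℝ T := by
    by_contra hmem
    obtain ⟨ε, hε, hle⟩ := T.rayleighQuotient_le_of_norm_mem_resolventSet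
      (by simpa [spectrum] using hmem)
    have : ‖T‖ ≤ ‖T‖ - ε := by
      conv_lhs => rw [T.norm_eq_iSup_rayleighQuotient hTsymm]
      exact ciSup_le fun x ↦ by rw [abs_of_nonneg (hTnonneg x)]; exact hle x
    linarith
  have hmem' : ‖T‖ - ‖H‖ ∈ spectrum ℝ H := by
    have := (spectrum.add_mem_add_iff (R := ℝ) (a := H) (r := ‖T‖ - ‖H‖) (s := ‖H‖)).1
    apply this
    rw [hT, add_comm] at hmem
    simpa [hT, add_comm] using hmem
  have hle := le_csSup (spectrum.isBounded H).bddAbove hmem'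
  have h1 := (le_abs_self _).trans (abs_real_inner_le_norm (T f) f)
  have h2 := T.le_opNorm f
  rw [hTapp] at h1
  nlinarith [norm_nonneg f, sq_nonneg ‖f‖]

section Correlation

variable {B Z : Type*} [AddCommGroup B] [AddCommGroup Z]

/-- Square-summable real functions. -/
def SqSummable {B : Type*} (f : B → ℝ) : Prop := Summable fun x ↦ f x ^ 2

/-- The squared `ℓ²`-norm. -/
noncomputable def mass {B : Type*} (f : B → ℝ) : ℝ := ∑' x, f x ^ 2

/-- The `ℓ²`-pairing of `f` with a translate of `g`. -/
noncomputable def corr {B : Type*} [Add B] (f g : B → ℝ) (s : B) : ℝ := ∑' x, f x * g (x + s)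

theorem SqSummable.mul {B : Type*} {f g : B → ℝ} (hf : SqSummable f) (hg : SqSummable g) :
    Summable fun x ↦ f x * g x := by
  refine Summable.of_norm_bounded (hf.add hg) fun x ↦ ?_
  rw [Real.norm_eq_abs, abs_mul, ← sq_abs (f x), ← sq_abs (g x)]
  nlinarith [sq_nonneg (|f x| - |g x|), sq_nonneg (|f x|), sq_nonneg (|g x|)]

theorem SqSummable.of_abs_le {B : Type*} {f g : B → ℝ} (hf : SqSummable f) (C : ℝ)
    (h : ∀ x, |g x| ≤ C * |f x|) : SqSummable g := by
  refine Summable.of_nonneg_of_le (fun x ↦ sq_nonneg _) (fun x ↦ ?_) (hf.mul_left (C ^ 2))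
  have := pow_le_pow_left₀ (abs_nonneg _) (h x) 2
  rwa [mul_pow, sq_abs, sq_abs] at this

theorem SqSummable.shift {f : B → ℝ} (hf : SqSummable f) (s : B) :
    SqSummable fun x ↦ f (x + s) :=
  (Equiv.addRight s).summable_iff (f := fun x ↦ f x ^ 2).2 hf

theorem SqSummable.corr_summable {f g : B → ℝ} (hf : SqSummable f) (hg : SqSummable g) (s : B) :
    Summable fun x ↦ f x * g (x + s) :=
  hf.mul (hg.shift s)

theorem SqSummable.indicator_mul {B : Type*} {f g : B → ℝ} (hf : SqSummable f)
    (hg : SqSummable g) (P : B → Prop) [DecidablePred P] :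
    Summable fun x ↦ (if P x then (1 : ℝ) else 0) * (f x * g x) := by
  refine Summable.of_norm_bounded (hf.mul hg).norm fun x ↦ ?_
  split_ifs <;> simp [mul_nonneg]

theorem SqSummable.indicator {B : Type*} {f : B → ℝ} (hf : SqSummable f)
    (P : B → Prop) [DecidablePred P] :
    Summable fun x ↦ (if P x then (1 : ℝ) else 0) * f x ^ 2 := by
  simpa only [sq] using hf.indicator_mul hf P

theorem mass_nonneg {B : Type*} (f : B → ℝ) : 0 ≤ mass f := tsum_nonneg fun _ ↦ sq_nonneg _

theorem mass_shift (f : B → ℝ) (s : B) : mass (fun x ↦ f (x + s)) = mass f :=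
  (Equiv.addRight s).tsum_eq (f := fun x ↦ f x ^ 2)

theorem corr_neg (f g : B → ℝ) (s : B) : corr f g (-s) = corr g f s := by
  unfold corr
  rw [← (Equiv.addRight s).tsum_eq]
  simp [mul_comm]

theorem corr_zero (f : B → ℝ) : corr f f 0 = mass f := by
  simp [corr, mass, sq]

theorem two_mul_tsum_mul_le {B : Type*} {f g : B → ℝ} (hf : SqSummable f) (hg : SqSummable g) :
    2 * ∑' x, f x * g x ≤ mass f + mass g := by
  rw [mass, mass, ← hf.tsum_add hg, ← tsum_mul_left]
  exact ((hf.mul hg).mul_left 2).tsum_le_tsum (fun x ↦ by nlinarith [sq_nonneg (f x - g x)])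
    (hf.add hg)

theorem sq_tsum_mul_le {B : Type*} {f g : B → ℝ} (hf : SqSummable f) (hg : SqSummable g) :
    (∑' x, f x * g x) ^ 2 ≤ mass f * mass g := by
  have h : discrim (mass f) (2 * ∑' x, f x * g x) (mass g) ≤ 0 := by
    refine discrim_le_zero fun t ↦ ?_
    have : mass (fun x ↦ t * f x + g x)
        = mass f * (t * t) + 2 * (∑' x, f x * g x) * t + mass g := by
      have h := (((Summable.hasSum hf).mul_left (t * t)).add
        ((hf.mul hg).hasSum.mul_left (2 * t))).add (Summable.hasSum hg)
      simp only [mass]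
      convert h.tsum_eq using 1
      · congr 1 with x
        ring
      · ring
    rw [← this]
    exact mass_nonneg _
  rw [discrim] at h
  linarith

theorem corr_le_mass {f : B → ℝ} (hf : SqSummable f) (s : B) : corr f f s ≤ mass f := by
  have := two_mul_tsum_mul_le hf (hf.shift s)
  rw [mass_shift] at this
  unfold corr
  linarith

theorem corr_comp_addEquiv {B' : Type*} [AddCommGroup B'] (φ : B ≃+ B') (f : B' → ℝ) (s : B) :
    corr (fun x ↦ f (φ x)) (fun x ↦ f (φ x)) s = corr f f (φ s) := by
  unfold corr
  rw [← φ.toEquiv.tsum_eq]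
  simp

theorem mass_comp_equiv {B B' : Type*} (φ : B ≃ B') (f : B' → ℝ) :
    mass (fun x ↦ f (φ x)) = mass f :=
  φ.tsum_eq (f := fun x ↦ f x ^ 2)

theorem SqSummable.comp_equiv {B B' : Type*} (φ : B ≃ B') {f : B' → ℝ} (hf : SqSummable f) :
    SqSummable fun x ↦ f (φ x) :=
  φ.summable_iff (f := fun x ↦ f x ^ 2).2 hf

/-- Square root of the marginal of `f ^ 2` on the first factor. -/
noncomputable def marg {B Z : Type*} (f : B × Z → ℝ) (b : B) : ℝ := √(∑' z, f (b, z) ^ 2)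

/-- The square root of the density of two particles that are conditionally independent given the
first factor, each distributed as under `f ^ 2`. -/
noncomputable def condProd {B Z : Type*} (f : B × Z → ℝ) (x : (B × Z) × Z) : ℝ :=
  f x.1 * f (x.1.1, x.2) / marg f x.1.1

section Marginal

variable {B Z : Type*} {f : B × Z → ℝ}

theorem SqSummable.slice (hf : SqSummable f) (b : B) : SqSummable fun z ↦ f (b, z) :=
  Summable.prod_factor (f := fun x ↦ f x ^ 2) hf b

theorem marg_nonneg (b : B) : 0 ≤ marg f b := Real.sqrt_nonneg _

theorem marg_sq (b : B) : marg f b ^ 2 = mass fun z ↦ f (b, z) :=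
  Real.sq_sqrt (mass_nonneg _)

theorem SqSummable.marg (hf : SqSummable f) : SqSummable (marg f) := by
  unfold SqSummable
  simp_rw [marg_sq]
  exact Summable.prod (f := fun x ↦ f x ^ 2) hf

theorem tsum_mul_marg_sq (hf : SqSummable f) (P : B → Prop) [DecidablePred P] :
    ∑' b, (if P b then (1 : ℝ) else 0) * marg f b ^ 2
      = ∑' x, (if P x.1 then (1 : ℝ) else 0) * f x ^ 2 := by
  rw [(hf.indicator fun x ↦ P x.1).tsum_prod]
  congr 1 with b
  rw [marg_sq]
  exact tsum_mul_left.symm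

theorem mass_marg (hf : SqSummable f) : mass (marg f) = mass f := by
  simpa [mass] using tsum_mul_marg_sq hf fun _ ↦ True

theorem eq_zero_of_marg_eq_zero (hf : SqSummable f) {b : B} (h : marg f b = 0) (z : Z) :
    f (b, z) = 0 := by
  have h1 : f (b, z) ^ 2 ≤ marg f b ^ 2 := by
    rw [marg_sq]
    exact (hf.slice b).le_tsum z fun _ _ ↦ sq_nonneg _
  rw [h] at h1
  nlinarith

theorem hasSum_condProd_mul (hf : SqSummable f) (b : B) (z w : Z) :
    HasSum (fun z' ↦ condProd f ((b, z), z') * condProd f ((b, w), z')) (f (b, z) * f (b, w)) := by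
  have h : HasSum (fun z' ↦ f (b, z) * f (b, w) / marg f b ^ 2 * f (b, z') ^ 2)
      (f (b, z) * f (b, w) / marg f b ^ 2 * marg f b ^ 2) := by
    rw [marg_sq]
    exact (Summable.hasSum (hf.slice b)).mul_left _
  convert h using 1
  · ext z'
    simp only [condProd]
    ring
  · by_cases h0 : marg f b = 0
    · simp [h0, eq_zero_of_marg_eq_zero hf h0]
    · field_simp

theorem SqSummable.condProd (hf : SqSummable f) : SqSummable (condProd f) := by
  have h (x : B × Z) := hasSum_condProd_mul hf x.1 x.2 x.2
  simp_rw [← sq] at h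
  refine (summable_prod_of_nonneg fun _ ↦ sq_nonneg _).2 ⟨fun x ↦ (h x).summable, ?_⟩
  simp_rw [fun x : B × Z ↦ (h x).tsum_eq]
  exact hf

theorem tsum_mul_condProd_sq (hf : SqSummable f) (P : B × Z → Prop) [DecidablePred P] :
    ∑' x, (if P x.1 then (1 : ℝ) else 0) * condProd f x ^ 2
      = ∑' x, (if P x then (1 : ℝ) else 0) * f x ^ 2 := by
  have h (x : B × Z) := hasSum_condProd_mul hf x.1 x.2 x.2
  simp_rw [← sq] at h
  rw [(hf.condProd.indicator fun x ↦ P x.1).tsum_prod]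
  congr 1 with x
  rw [← (h x).tsum_eq, ← tsum_mul_left]

theorem mass_condProd (hf : SqSummable f) : mass (condProd f) = mass f := by
  simpa [mass] using tsum_mul_condProd_sq hf fun _ ↦ True

/-- Exchange of the two particles attached to the same base point. -/
def pairSwap (B Z : Type*) : (B × Z) × Z ≃ (B × Z) × Z where
  toFun x := ((x.1.1, x.2), x.1.2)
  invFun x := ((x.1.1, x.2), x.1.2)
  left_inv _ := rfl
  right_inv _ := rfl

theorem condProd_pairSwap (x : (B × Z) × Z) : condProd f (pairSwap B Z x) = condProd f x := by
  simp only [condProd, pairSwap, Equiv.coe_fn_mk]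
  ring

theorem tsum_mul_condProd_sq_right (hf : SqSummable f) (P : Z → Prop) [DecidablePred P] :
    ∑' x, (if P x.2 then (1 : ℝ) else 0) * condProd f x ^ 2
      = ∑' x, (if P x.2 then (1 : ℝ) else 0) * f x ^ 2 := by
  rw [← tsum_mul_condProd_sq hf fun x ↦ P x.2, ← (pairSwap B Z).tsum_eq]
  simp_rw [condProd_pairSwap]
  rfl

end Marginal

variable {f : B × Z → ℝ}

theorem corr_condProd_left (hf : SqSummable f) (t : Z) :
    corr (condProd f) (condProd f) ((0, t), 0) = corr f f (0, t) := by
  unfold corr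
  rw [(hf.condProd.corr_summable hf.condProd _).tsum_prod]
  congr 1 with ⟨b, z⟩
  simpa using (hasSum_condProd_mul hf b z (z + t)).tsum_eq

theorem corr_condProd_right (hf : SqSummable f) (t : Z) :
    corr (condProd f) (condProd f) ((0, 0), t) = corr f f (0, t) := by
  rw [← corr_condProd_left hf]
  unfold corr
  rw [← (pairSwap B Z).tsum_eq]
  congr 1 with x
  rw [condProd_pairSwap, ← condProd_pairSwap (x + _)]
  rfl

theorem corr_le_corr_marg (hf : SqSummable f) (s : B) (t : Z) :
    corr f f (s, t) ≤ corr (marg f) (marg f) s := by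
  unfold corr
  rw [(hf.corr_summable hf _).tsum_prod]
  refine (hf.corr_summable hf (s, t)).prod.tsum_le_tsum (fun b ↦ ?_)
    (hf.marg.corr_summable hf.marg s)
  refine le_of_sq_le_sq ?_ (mul_nonneg (marg_nonneg _) (marg_nonneg _))
  rw [mul_pow, marg_sq, marg_sq, ← mass_shift (fun z ↦ f (b + s, z)) t]
  exact sq_tsum_mul_le (hf.slice b) ((hf.slice (b + s)).shift t)

theorem sq_tsum_eq {Z : Type*} {h : Z → ℝ} (hs : Summable h) :
    (∑' z, h z) ^ 2 = ∑' y : Z × Z, h y.1 * h y.2 := by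
  rw [sq, hs.tsum_mul_tsum hs (summable_mul_of_summable_norm hs.norm hs.norm)]

theorem two_mul_corr_le (hf : SqSummable f) (s : B) (t : Z) :
    2 * corr f f (s, t)
      ≤ corr (marg f) (marg f) s + corr (condProd f) (condProd f) ((s, t), t) := by
  have hG := hf.condProd.corr_summable hf.condProd ((s, t), t)
  have hG' : Summable fun y : B × Z × Z ↦ condProd f ((Equiv.prodAssoc B Z Z).symm y) *
      condProd f ((Equiv.prodAssoc B Z Z).symm y + ((s, t), t)) :=
    (Equiv.prodAssoc B Z Z).symm.summable_iff.2 hG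
  have hF := hf.marg.corr_summable hf.marg s
  have hff := hf.corr_summable hf (s, t)
  unfold corr
  rw [hff.tsum_prod, ← (Equiv.prodAssoc B Z Z).symm.tsum_eq (fun x ↦ condProd f x * _),
    hG'.tsum_prod, ← hF.tsum_add hG'.prod, ← tsum_mul_left]
  refine (hff.prod.mul_left 2).tsum_le_tsum (fun b ↦ ?_) (hF.add hG'.prod)
  have hs := (hf.slice b).mul ((hf.slice (b + s)).shift t)
  have key : ∑' y : Z × Z, condProd f ((Equiv.prodAssoc B Z Z).symm (b, y)) *
      condProd f ((Equiv.prodAssoc B Z Z).symm (b, y) + ((s, t), t))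
      = (∑' z, f (b, z) * f (b + s, z + t)) ^ 2 / (marg f b * marg f (b + s)) := by
    rw [sq_tsum_eq hs, ← tsum_div_const]
    congr 1 with ⟨z, z'⟩
    change (f (b, z) * f (b, z') / marg f b) *
      (f (b + s, z + t) * f (b + s, z' + t) / marg f (b + s)) = _
    generalize marg f b = m, marg f (b + s) = m'
    ring
  simp only [Prod.mk_add_mk] at key ⊢
  rw [key]
  set a := ∑' z, f (b, z) * f (b + s, z + t) with ha
  by_cases h0 : marg f b * marg f (b + s) = 0
  · have : a = 0 := by
      rcases mul_eq_zero.1 h0 with h | h <;> simp [ha, eq_zero_of_marg_eq_zero hf h]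
    simp [this, h0]
  · have hpos : 0 < marg f b * marg f (b + s) :=
      lt_of_le_of_ne (mul_nonneg (marg_nonneg _) (marg_nonneg _)) (Ne.symm h0)
    set c := marg f b * marg f (b + s)
    have : c + a ^ 2 / c - 2 * a = (a - c) ^ 2 / c := by field_simp; ring
    have : 0 ≤ (a - c) ^ 2 / c := by positivity
    linarith

end Correlation

section Energy

variable {Z J : Type*} [AddCommGroup Z]

/-- Separating the `i`-th particle from the others. -/
def splitAt (Z : Type*) [AddCommGroup Z] {n : ℕ} (i : Fin (n + 1)) :
    (Fin (n + 1) → Z) ≃+ (Fin n → Z) × Z where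
  toFun x := (i.removeNth x, x i)
  invFun y := i.insertNth y.2 y.1
  left_inv x := by simp
  right_inv y := by simp
  map_add' x y := rfl

theorem splitAt_apply {n : ℕ} (i : Fin (n + 1)) (x : Fin (n + 1) → Z) :
    splitAt Z i x = (fun k ↦ x (i.succAbove k), x i) := rfl

theorem splitAt_single_self {n : ℕ} (i : Fin (n + 1)) (t : Z) :
    splitAt Z i (Pi.single i t) = (0, t) := by
  rw [splitAt_apply]
  refine Prod.ext (funext fun k ↦ ?_) ?_ <;> simp

theorem splitAt_single_succAbove {n : ℕ} (i : Fin (n + 1)) (k : Fin n) (t : Z) :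
    splitAt Z i (Pi.single (i.succAbove k) t) = (Pi.single k t, 0) := by
  rw [splitAt_apply]
  refine Prod.ext (funext fun l ↦ ?_) ?_ <;> simp [Pi.single_apply]

theorem splitAt_const {n : ℕ} (i : Fin (n + 1)) (t : Z) :
    splitAt Z i (fun _ ↦ t) = (fun _ ↦ t, t) := rfl

/-- Separating two particles from the others. -/
def splitTwo (Z : Type*) [AddCommGroup Z] (n : ℕ) :
    (Fin (n + 2) → Z) ≃+ ((Fin n → Z) × Z) × Z :=
  (splitAt Z 0).trans ((splitAt Z 0).prodCongr (AddEquiv.refl Z))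

variable [DecidableEq Z] [Fintype J]

/-- The part of the squared norm of `f` carried by the zero set of `u`. -/
noncomputable def zeroMass {B : Type*} (u : B → Z) (f : B → ℝ) : ℝ :=
  ∑' x, (if u x = 0 then (1 : ℝ) else 0) * f x ^ 2

/-- The quadratic form of the `n`-particle Hamiltonian. -/
noncomputable def energy (κ ρ γ : ℝ) (e : J → Z) {n : ℕ} (f : (Fin n → Z) → ℝ) : ℝ :=
  2 * κ * (∑ i, ∑ j, (corr f f (Pi.single i (e j)) - mass f))
    + 2 * ρ * (∑ j, (corr f f (fun _ ↦ e j) - mass f))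
    + γ * ∑ i, zeroMass (fun x ↦ x i) f

theorem zeroMass_comp_equiv {B B' : Type*} (φ : B ≃ B') (u : B' → Z) (f : B' → ℝ) :
    zeroMass (fun x ↦ u (φ x)) (fun x ↦ f (φ x)) = zeroMass u f :=
  φ.tsum_eq (f := fun x ↦ (if u x = 0 then (1 : ℝ) else 0) * f x ^ 2)

theorem zeroMass_le_mass {B : Type*} (u : B → Z) {f : B → ℝ} (hf : SqSummable f) :
    zeroMass u f ≤ mass f :=
  (hf.indicator fun x ↦ u x = 0).tsum_le_tsum (fun x ↦ by split_ifs <;> nlinarith [sq_nonneg (f x)])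
    hf

theorem energy_comp_splitAt (κ ρ γ : ℝ) (e : J → Z) {n : ℕ} (i : Fin (n + 1))
    (f : (Fin n → Z) × Z → ℝ) :
    energy κ ρ γ e (fun x ↦ f (splitAt Z i x))
      = 2 * κ * (∑ j, (corr f f (0, e j) - mass f)
          + ∑ k, ∑ j, (corr f f (Pi.single k (e j), 0) - mass f))
        + 2 * ρ * (∑ j, (corr f f (fun _ ↦ e j, e j) - mass f))
        + γ * (zeroMass (fun x ↦ x.2) f + ∑ k, zeroMass (fun x ↦ x.1 k) f) := by
  rw [energy, Fin.sum_univ_succAbove _ i, Fin.sum_univ_succAbove _ i]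
  simp only [corr_comp_addEquiv, splitAt_single_self, splitAt_single_succAbove, splitAt_const]
  rw [show mass (fun x ↦ f (splitAt Z i x)) = mass f from mass_comp_equiv (splitAt Z i).toEquiv f,
    ← zeroMass_comp_equiv (splitAt Z i).toEquiv (fun x ↦ x.2) f]
  simp_rw [← zeroMass_comp_equiv (splitAt Z i).toEquiv (fun x ↦ x.1 _) f]
  rfl

theorem energy_le_marg {κ ρ γ : ℝ} (hκ : 0 ≤ κ) (hρ : 0 ≤ ρ) (e : J → Z) {n : ℕ}
    (i : Fin (n + 1)) {f : (Fin n → Z) × Z → ℝ} (hf : SqSummable f) :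
    energy κ ρ γ e (fun x ↦ f (splitAt Z i x))
      ≤ energy κ ρ γ e (marg f) + γ * zeroMass (fun x ↦ x.2) f := by
  rw [energy_comp_splitAt, energy, mass_marg hf]
  have h1 : ∑ j, (corr f f (0, e j) - mass f) ≤ 0 :=
    Finset.sum_nonpos fun j _ ↦ sub_nonpos.2 (corr_le_mass hf _)
  have h2 : ∑ k, ∑ j, (corr f f (Pi.single k (e j), 0) - mass f)
      ≤ ∑ k, ∑ j, (corr (marg f) (marg f) (Pi.single k (e j)) - mass f) := by
    gcongr
    exact corr_le_corr_marg hf _ _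
  have h3 : ∑ j, (corr f f (fun _ ↦ e j, e j) - mass f)
      ≤ ∑ j, (corr (marg f) (marg f) (fun _ ↦ e j) - mass f) := by
    gcongr
    exact corr_le_corr_marg hf _ _
  have h4 (k : Fin n) : zeroMass (fun x ↦ x.1 k) f = zeroMass (fun x ↦ x k) (marg f) :=
    (tsum_mul_marg_sq hf fun x ↦ x k = 0).symm
  simp_rw [h4]
  nlinarith [mul_le_mul_of_nonneg_left (add_le_add h1 h2) hκ, mul_le_mul_of_nonneg_left h3 hρ]

theorem energy_comp_splitTwo (κ ρ γ : ℝ) (e : J → Z) {n : ℕ} (f : ((Fin n → Z) × Z) × Z → ℝ) :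
    energy κ ρ γ e (fun x ↦ f (splitTwo Z n x))
      = 2 * κ * (∑ j, (corr f f ((0, 0), e j) - mass f)
          + (∑ j, (corr f f ((0, e j), 0) - mass f)
          + ∑ k, ∑ j, (corr f f ((Pi.single k (e j), 0), 0) - mass f)))
        + 2 * ρ * (∑ j, (corr f f ((fun _ ↦ e j, e j), e j) - mass f))
        + γ * (zeroMass (fun x ↦ x.2) f + (zeroMass (fun x ↦ x.1.2) f
          + ∑ k, zeroMass (fun x ↦ x.1.1 k) f)) := by
  set ψ : (Fin (n + 1) → Z) × Z ≃+ ((Fin n → Z) × Z) × Z :=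
    (splitAt Z 0).prodCongr (AddEquiv.refl Z) with hψ
  have hψ' (s : Fin (n + 1) → Z) (t : Z) : ψ (s, t) = (splitAt Z 0 s, t) := rfl
  refine (energy_comp_splitAt κ ρ γ e 0 fun y ↦ f (ψ y)).trans ?_
  rw [Fin.sum_univ_succAbove _ 0, Fin.sum_univ_succAbove _ 0]
  rw [show mass (fun x ↦ f (ψ x)) = mass f from mass_comp_equiv ψ.toEquiv f,
    ← zeroMass_comp_equiv ψ.toEquiv (fun x ↦ x.2) f,
    ← zeroMass_comp_equiv ψ.toEquiv (fun x ↦ x.1.2) f]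
  simp_rw [← zeroMass_comp_equiv ψ.toEquiv (fun x ↦ x.1.1 _) f]
  simp only [corr_comp_addEquiv]
  simp only [hψ', splitAt_single_self, splitAt_single_succAbove, splitAt_const, map_zero]
  rfl

theorem two_mul_energy_le {κ ρ : ℝ} (hκ : 0 ≤ κ) (hρ : 0 ≤ ρ) (γ : ℝ) (e : J → Z) {n : ℕ}
    {f : (Fin n → Z) × Z → ℝ} (hf : SqSummable f) :
    2 * energy κ ρ γ e (fun x ↦ f (splitAt Z 0 x))
      ≤ energy κ ρ γ e (marg f) + energy κ ρ γ e (fun x ↦ condProd f (splitTwo Z n x)) := by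
  rw [energy_comp_splitAt, energy_comp_splitTwo, energy, mass_marg hf, mass_condProd hf]
  simp only [corr_condProd_left hf, corr_condProd_right hf]
  have h2 : 2 * ∑ k, ∑ j, (corr f f (Pi.single k (e j), 0) - mass f)
      ≤ ∑ k, ∑ j, (corr (marg f) (marg f) (Pi.single k (e j)) - mass f) +
        ∑ k, ∑ j, (corr (condProd f) (condProd f) ((Pi.single k (e j), 0), 0) - mass f) := by
    simp only [Finset.mul_sum, ← Finset.sum_add_distrib]
    gcongr with k _ j
    linarith [two_mul_corr_le hf (Pi.single k (e j)) 0]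
  have h3 : 2 * ∑ j, (corr f f (fun _ ↦ e j, e j) - mass f)
      ≤ ∑ j, (corr (marg f) (marg f) (fun _ ↦ e j) - mass f) +
        ∑ j, (corr (condProd f) (condProd f) ((fun _ ↦ e j, e j), e j) - mass f) := by
    simp only [Finset.mul_sum, ← Finset.sum_add_distrib]
    gcongr with j
    linarith [two_mul_corr_le hf (fun _ ↦ e j) (e j)]
  have h4 (k : Fin n) : zeroMass (fun x ↦ x k) (marg f) = zeroMass (fun x ↦ x.1 k) f :=
    tsum_mul_marg_sq hf fun x ↦ x k = 0
  have h5 (k : Fin n) : zeroMass (fun x ↦ x.1.1 k) (condProd f) = zeroMass (fun x ↦ x.1 k) f :=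
    tsum_mul_condProd_sq hf fun x ↦ x.1 k = 0
  have h6 : zeroMass (fun x ↦ x.1.2) (condProd f) = zeroMass (fun x ↦ x.2) f :=
    tsum_mul_condProd_sq hf fun x ↦ x.2 = 0
  have h7 : zeroMass (fun x ↦ x.2) (condProd f) = zeroMass (fun x ↦ x.2) f :=
    tsum_mul_condProd_sq_right hf fun z ↦ z = 0
  simp_rw [h4, h5, h6, h7]
  linarith [mul_le_mul_of_nonneg_left h2 hκ, mul_le_mul_of_nonneg_left h3 hρ]

/-- `c` bounds the quadratic form of the `n`-particle Hamiltonian from above. -/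
def IsEnergyBound (κ ρ γ : ℝ) (e : J → Z) (n : ℕ) (c : ℝ) : Prop :=
  ∀ f : (Fin n → Z) → ℝ, SqSummable f → energy κ ρ γ e f ≤ c * mass f

/-- The top of the spectrum of the `n`-particle Hamiltonian. -/
noncomputable def topEnergy (κ ρ γ : ℝ) (e : J → Z) (n : ℕ) : ℝ :=
  sInf {c | IsEnergyBound κ ρ γ e n c}

variable {κ ρ γ : ℝ}

theorem isEnergyBound_mul (hκ : 0 ≤ κ) (hρ : 0 ≤ ρ) (hγ : 0 ≤ γ) (e : J → Z) (n : ℕ) :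
    IsEnergyBound κ ρ γ e n (γ * n) := by
  intro f hf
  have h1 : ∑ i, ∑ j, (corr f f (Pi.single i (e j)) - mass f) ≤ 0 :=
    Finset.sum_nonpos fun i _ ↦ Finset.sum_nonpos fun j _ ↦ sub_nonpos.2 (corr_le_mass hf _)
  have h2 : ∑ j, (corr f f (fun _ ↦ e j) - mass f) ≤ 0 :=
    Finset.sum_nonpos fun j _ ↦ sub_nonpos.2 (corr_le_mass hf _)
  have h3 : ∑ i : Fin n, zeroMass (fun x ↦ x i) f ≤ n * mass f := by
    refine (Finset.sum_le_sum fun i _ ↦ zeroMass_le_mass (fun x ↦ x i) hf).trans ?_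
    simp
  rw [energy]
  nlinarith [mul_nonneg hκ (neg_nonneg.2 h1), mul_nonneg hρ (neg_nonneg.2 h2),
    mul_le_mul_of_nonneg_left h3 hγ]

theorem bddBelow_isEnergyBound (κ ρ γ : ℝ) (e : J → Z) (n : ℕ) :
    BddBelow {c | IsEnergyBound κ ρ γ e n c} := by
  set δ : (Fin n → Z) → ℝ := fun x ↦ if x = 0 then 1 else 0 with hδ
  have h1 : HasSum (fun x ↦ δ x ^ 2) 1 := by
    convert hasSum_ite_eq (0 : Fin n → Z) (1 : ℝ) using 2 with x
    simp [hδ]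
  refine ⟨energy κ ρ γ e δ, fun c hc ↦ ?_⟩
  simpa [mass, h1.tsum_eq] using hc δ h1.summable

theorem isEnergyBound_topEnergy (hκ : 0 ≤ κ) (hρ : 0 ≤ ρ) (hγ : 0 ≤ γ) (e : J → Z) (n : ℕ) :
    IsEnergyBound κ ρ γ e n (topEnergy κ ρ γ e n) := by
  intro f hf
  rcases (mass_nonneg f).eq_or_lt with h | h
  · simpa [← h] using isEnergyBound_mul hκ hρ hγ e n f hf
  · rw [← div_le_iff₀ h]
    exact le_csInf ⟨_, isEnergyBound_mul hκ hρ hγ e n⟩ fun c hc ↦ (div_le_iff₀ h).2 (hc f hf)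

theorem IsEnergyBound.topEnergy_le {e : J → Z} {n : ℕ} {c : ℝ}
    (h : IsEnergyBound κ ρ γ e n c) : topEnergy κ ρ γ e n ≤ c :=
  csInf_le (bddBelow_isEnergyBound κ ρ γ e n) h

/-- Convexity of the top energy in the number of particles. -/
theorem two_mul_topEnergy_le (hκ : 0 ≤ κ) (hρ : 0 ≤ ρ) (hγ : 0 ≤ γ) (e : J → Z) (n : ℕ) :
    2 * topEnergy κ ρ γ e (n + 1) ≤ topEnergy κ ρ γ e n + topEnergy κ ρ γ e (n + 2) := by
  suffices IsEnergyBound κ ρ γ e (n + 1)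
      ((topEnergy κ ρ γ e n + topEnergy κ ρ γ e (n + 2)) / 2) by
    linarith [this.topEnergy_le]
  intro f hf
  set g : (Fin n → Z) × Z → ℝ := fun y ↦ f ((splitAt Z 0).symm y) with hg
  have hfg : f = fun x ↦ g (splitAt Z 0 x) := by ext; simp [hg]
  have hgs : SqSummable g := hf.comp_equiv (splitAt Z 0).symm.toEquiv
  have hm : mass g = mass f := mass_comp_equiv (splitAt Z 0).symm.toEquiv f
  have h1 := two_mul_energy_le hκ hρ γ e hgs
  have h2 := isEnergyBound_topEnergy hκ hρ hγ e n _ hgs.marg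
  have h3 := isEnergyBound_topEnergy hκ hρ hγ e (n + 2) (fun x ↦ condProd g (splitTwo Z n x))
    (hgs.condProd.comp_equiv (splitTwo Z n).toEquiv)
  rw [show mass (fun x ↦ condProd g (splitTwo Z n x)) = mass (condProd g) from
    mass_comp_equiv (splitTwo Z n).toEquiv _, mass_condProd hgs, hm] at h3
  rw [mass_marg hgs, hm] at h2
  rw [← hfg] at h1
  linarith

theorem mul_topEnergy_le (hκ : 0 ≤ κ) (hρ : 0 ≤ ρ) (hγ : 0 ≤ γ) (e : J → Z) (n : ℕ) :
    (n + 1) * topEnergy κ ρ γ e n ≤ n * topEnergy κ ρ γ e (n + 1) := by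
  induction n with
  | zero =>
    suffices IsEnergyBound κ ρ γ e 0 0 by simpa using this.topEnergy_le
    simpa using isEnergyBound_mul hκ hρ hγ e 0
  | succ n ih =>
    have := two_mul_topEnergy_le hκ hρ hγ e n
    push_cast
    nlinarith

/-- A function vanishing whenever the `i`-th particle sits at the origin has at most the top energy
of a system with one particle less. -/
theorem energy_le_of_vanish (hκ : 0 ≤ κ) (hρ : 0 ≤ ρ) (hγ : 0 ≤ γ) (e : J → Z) {n : ℕ}
    (i : Fin (n + 1)) {f : (Fin (n + 1) → Z) → ℝ} (hf : SqSummable f)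
    (hv : ∀ x, x i = 0 → f x = 0) :
    energy κ ρ γ e f ≤ topEnergy κ ρ γ e n * mass f := by
  set g : (Fin n → Z) × Z → ℝ := fun y ↦ f ((splitAt Z i).symm y) with hg
  have hfg : f = fun x ↦ g (splitAt Z i x) := by ext; simp [hg]
  have hgs : SqSummable g := hf.comp_equiv (splitAt Z i).symm.toEquiv
  have hm : mass g = mass f := mass_comp_equiv (splitAt Z i).symm.toEquiv f
  have h1 := energy_le_marg (γ := γ) hκ hρ e i hgs
  have h2 := isEnergyBound_topEnergy hκ hρ hγ e n _ hgs.marg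
  have h3 : zeroMass (fun x ↦ x.2) g = 0 := by
    refine (tsum_congr fun y ↦ ?_).trans tsum_zero
    split_ifs with h
    · have : (splitAt Z i ((splitAt Z i).symm y)).2 = 0 := by simpa using h
      exact mul_eq_zero_of_right _ (by rw [hg]; simp [hv ((splitAt Z i).symm y) this])
    · simp
  rw [mass_marg hgs, hm] at h2
  rw [← hfg, h3] at h1
  linarith

end Energy

theorem hasSum_of_forall_eq {B : Type*} {f g : B → ℝ} {a : ℝ} (h : ∀ x, f x = g x)
    (hg : HasSum g a) : HasSum f a :=
  funext h ▸ hg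

section Hamiltonian

variable {Z J : Type*} [AddCommGroup Z]

/-- The second difference of `g` in direction `s`. -/
def secondDiff {B : Type*} [AddCommGroup B] (g : B → ℝ) (s x : B) : ℝ :=
  (g (x + s) - g x) + (g (x - s) - g x)

theorem hasSum_mul_secondDiff {B : Type*} [AddCommGroup B] {f g : B → ℝ} (hf : SqSummable f)
    (hg : SqSummable g) (s : B) :
    HasSum (fun x ↦ f x * secondDiff g s x)
      (corr f g s + corr f g (-s) - 2 * corr f g 0) := by
  refine hasSum_of_forall_eq (fun x ↦ ?_) (((hf.corr_summable hg s).hasSum.add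
    (hf.corr_summable hg (-s)).hasSum).sub ((hf.corr_summable hg 0).hasSum.mul_left 2))
  simp only [secondDiff, add_zero, ← sub_eq_add_neg]
  ring

/-- Discrete integration by parts against a weight of small relative variation. -/
theorem corr_weight_le {B : Type*} [AddCommGroup B] {v w : B → ℝ} (hv : SqSummable v) {M η : ℝ}
    (hw : ∀ x, 0 ≤ w x) (hwM : ∀ x, w x ≤ M) (s : B)
    (h1 : ∀ x, |w (x + s) - w x| ≤ η * (w x + 1))
    (h2 : ∀ x, |w (x + s) - w x| ≤ η * (w (x + s) + 1)) :
    corr (fun x ↦ w x ^ 2 * v x) v s + corr (fun x ↦ w x ^ 2 * v x) v (-s)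
        - 2 * corr (fun x ↦ w x ^ 2 * v x) v 0
      ≤ 2 * (corr (fun x ↦ w x * v x) (fun x ↦ w x * v x) s - mass fun x ↦ w x * v x)
        + η ^ 2 * mass fun x ↦ (w x + 1) * v x := by
  have hM : 0 ≤ M := (hw 0).trans (hwM 0)
  have hwv : SqSummable fun x ↦ w x * v x := hv.of_abs_le M fun x ↦ by
    rw [abs_mul, abs_of_nonneg (hw x)]
    gcongr
    exact hwM x
  have hwwv : SqSummable fun x ↦ w x ^ 2 * v x := hv.of_abs_le (M ^ 2) fun x ↦ by
    have := hw x
    have := hwM x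
    rw [abs_mul, abs_of_nonneg (by positivity)]
    gcongr
  have hu : SqSummable fun x ↦ |(w x + 1) * v x| := hv.of_abs_le (M + 1) fun x ↦ by
    have := hw x
    have := hwM x
    rw [abs_abs, abs_mul, abs_of_nonneg (by positivity)]
    gcongr
  have hmass : mass (fun x ↦ |(w x + 1) * v x|) = mass fun x ↦ (w x + 1) * v x := by
    simp only [mass, sq_abs]
  have h0 : corr (fun x ↦ w x ^ 2 * v x) v 0 = mass fun x ↦ w x * v x := by
    simp only [corr, mass, add_zero]
    congr 1 with x
    ring
  have key : corr (fun x ↦ w x ^ 2 * v x) v s + corr v (fun x ↦ w x ^ 2 * v x) s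
      ≤ 2 * corr (fun x ↦ w x * v x) (fun x ↦ w x * v x) s
        + η ^ 2 * corr (fun x ↦ |(w x + 1) * v x|) (fun x ↦ |(w x + 1) * v x|) s := by
    refine hasSum_le (fun x ↦ ?_)
      ((hwwv.corr_summable hv s).hasSum.add (hv.corr_summable hwwv s).hasSum)
      (((hwv.corr_summable hwv s).hasSum.mul_left 2).add
        ((hu.corr_summable hu s).hasSum.mul_left (η ^ 2)))
    have ha := hw x
    have hb := hw (x + s)
    have h3 : (w (x + s) - w x) ^ 2 ≤ η ^ 2 * ((w x + 1) * (w (x + s) + 1)) := by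
      have := mul_le_mul (h1 x) (h2 x) (abs_nonneg _) ((abs_nonneg _).trans (h1 x))
      rw [abs_mul_abs_self] at this
      linarith
    have h4 : (w (x + s) - w x) ^ 2 * (v x * v (x + s))
        ≤ η ^ 2 * ((w x + 1) * (w (x + s) + 1)) * (|v x| * |v (x + s)|) := by
      rw [← abs_mul]
      exact (mul_le_mul_of_nonneg_left (le_abs_self _) (sq_nonneg _)).trans
        (mul_le_mul_of_nonneg_right h3 (abs_nonneg _))
    rw [abs_mul, abs_mul, abs_of_nonneg (by positivity : 0 ≤ w x + 1),
      abs_of_nonneg (by positivity : 0 ≤ w (x + s) + 1)]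
    linarith
  rw [corr_neg, h0]
  have := corr_le_mass hu s
  rw [hmass] at this
  have := mul_le_mul_of_nonneg_left this (sq_nonneg η)
  linarith

variable [DecidableEq Z] [Fintype J] {κ ρ γ : ℝ} {e : J → Z} {n : ℕ}

/-- The `n`-particle Hamiltonian acting on functions. -/
def ham (κ ρ γ : ℝ) (e : J → Z) (g : (Fin n → Z) → ℝ) (x : Fin n → Z) : ℝ :=
  κ * (∑ i, ∑ j, secondDiff g (Pi.single i (e j)) x)
    + ρ * (∑ j, secondDiff g (fun _ ↦ e j) x)
    + γ * ((∑ i, if x i = 0 then (1 : ℝ) else 0) * g x)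

/-- The bilinear form of the `n`-particle Hamiltonian. -/
noncomputable def hamForm (κ ρ γ : ℝ) (e : J → Z) (f g : (Fin n → Z) → ℝ) : ℝ :=
  κ * (∑ i, ∑ j, (corr f g (Pi.single i (e j)) + corr f g (-Pi.single i (e j)) - 2 * corr f g 0))
    + ρ * (∑ j, (corr f g (fun _ ↦ e j) + corr f g (-fun _ ↦ e j) - 2 * corr f g 0))
    + γ * ∑ i, ∑' x, (if x i = 0 then (1 : ℝ) else 0) * (f x * g x)

theorem hasSum_mul_ham {f g : (Fin n → Z) → ℝ} (hf : SqSummable f) (hg : SqSummable g) :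
    HasSum (fun x ↦ f x * ham κ ρ γ e g x) (hamForm κ ρ γ e f g) := by
  have h1 := (hasSum_sum fun i (_ : i ∈ Finset.univ) ↦ hasSum_sum fun j (_ : j ∈ Finset.univ) ↦
    hasSum_mul_secondDiff hf hg (Pi.single i (e j))).mul_left κ
  have h2 := (hasSum_sum fun j (_ : j ∈ Finset.univ) ↦
    hasSum_mul_secondDiff hf hg (fun _ ↦ e j)).mul_left ρ
  have h3 := (hasSum_sum fun i (_ : i ∈ Finset.univ) ↦
    (hf.indicator_mul hg fun x : Fin n → Z ↦ x i = 0).hasSum).mul_left γ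
  refine hasSum_of_forall_eq (fun x ↦ ?_) ((h1.add h2).add h3)
  simp only [ham, ← Finset.mul_sum, ← Finset.sum_mul]
  ring

theorem hamForm_comm (f g : (Fin n → Z) → ℝ) :
    hamForm κ ρ γ e f g = hamForm κ ρ γ e g f := by
  have h0 : corr f g 0 = corr g f 0 := by simpa using corr_neg f g 0
  have h (s) : corr f g s + corr f g (-s) = corr g f s + corr g f (-s) := by
    rw [corr_neg, corr_neg, add_comm]
  have hm (x) : f x * g x = g x * f x := mul_comm _ _
  simp only [hamForm, h, h0, hm]

theorem hamForm_self (f : (Fin n → Z) → ℝ) : hamForm κ ρ γ e f f = energy κ ρ γ e f := by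
  simp only [hamForm, energy, corr_neg, corr_zero, zeroMass, ← sq, ← two_mul, ← mul_sub,
    ← Finset.mul_sum]
  ring

/-- Exponential weights do not increase the norm of an eigenfunction much. -/
theorem mass_weight_le (hκ : 0 ≤ κ) (hρ : 0 ≤ ρ) (hγ : 0 ≤ γ) {l η M : ℝ}
    (hη : 4 * ((κ * (n + 1) + ρ) * Fintype.card J) * η ^ 2 < l - topEnergy κ ρ γ e n)
    {v w : (Fin (n + 1) → Z) → ℝ} (hv : SqSummable v) (hl : ∀ x, ham κ ρ γ e v x = l * v x)
    (i : Fin (n + 1)) (hw : ∀ x, 0 ≤ w x) (hwM : ∀ x, w x ≤ M) (hw0 : ∀ x, x i = 0 → w x = 0)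
    (hs1 : ∀ k j x, |w (x + Pi.single k (e j)) - w x| ≤ η * (w x + 1))
    (hs2 : ∀ k j x, |w (x + Pi.single k (e j)) - w x| ≤ η * (w (x + Pi.single k (e j)) + 1))
    (hc1 : ∀ j x, |w (x + fun _ ↦ e j) - w x| ≤ η * (w x + 1))
    (hc2 : ∀ j x, |w (x + fun _ ↦ e j) - w x| ≤ η * (w (x + fun _ ↦ e j) + 1)) :
    mass (fun x ↦ (w x + 1) * v x) ≤ 4 * mass v := by
  have hM : 0 ≤ M := (hw 0).trans (hwM 0)
  have hwv : SqSummable fun x ↦ w x * v x := hv.of_abs_le M fun x ↦ by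
    rw [abs_mul, abs_of_nonneg (hw x)]
    gcongr
    exact hwM x
  have hwwv : SqSummable fun x ↦ w x ^ 2 * v x := hv.of_abs_le (M ^ 2) fun x ↦ by
    have := hw x
    have := hwM x
    rw [abs_mul, abs_of_nonneg (by positivity)]
    gcongr
  have hu : SqSummable fun x ↦ (w x + 1) * v x := hv.of_abs_le (M + 1) fun x ↦ by
    have := hw x
    have := hwM x
    rw [abs_mul, abs_of_nonneg (by positivity)]
    gcongr
  set m := mass fun x ↦ w x * v x with hm
  set U := mass fun x ↦ (w x + 1) * v x with hU
  have hUle : U ≤ 2 * m + 2 * mass v := by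
    refine hasSum_le (fun x ↦ ?_) (Summable.hasSum hu)
      (((Summable.hasSum hwv).mul_left 2).add ((Summable.hasSum hv).mul_left 2))
    nlinarith [sq_nonneg (w x * v x - v x)]
  have heig : hamForm κ ρ γ e (fun x ↦ w x ^ 2 * v x) v = l * m := by
    refine (hasSum_mul_ham hwwv hv).unique ?_
    refine hasSum_of_forall_eq (fun x ↦ ?_) ((Summable.hasSum hwv).mul_left l)
    rw [hl]
    ring
  have hform : hamForm κ ρ γ e (fun x ↦ w x ^ 2 * v x) v
      ≤ energy κ ρ γ e (fun x ↦ w x * v x)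
        + ((κ * (n + 1) + ρ) * Fintype.card J) * (η ^ 2 * U) := by
    have h1 := Finset.sum_le_sum fun k (_ : k ∈ Finset.univ) ↦
      Finset.sum_le_sum fun j (_ : j ∈ Finset.univ) ↦
        corr_weight_le hv hw hwM _ (hs1 k j) (hs2 k j)
    have h2 := Finset.sum_le_sum fun j (_ : j ∈ Finset.univ) ↦
        corr_weight_le hv hw hwM _ (hc1 j) (hc2 j)
    have h3 (k : Fin (n + 1)) : ∑' x, (if x k = 0 then (1 : ℝ) else 0) * (w x ^ 2 * v x * v x)
        = zeroMass (fun x ↦ x k) fun x ↦ w x * v x := by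
      rw [zeroMass]
      congr 1 with x
      ring
    simp only [Finset.sum_add_distrib, ← Finset.mul_sum, Finset.sum_const, Finset.card_univ,
      Fintype.card_fin, nsmul_eq_mul] at h1 h2
    rw [hamForm, energy]
    simp_rw [h3]
    have h1' := mul_le_mul_of_nonneg_left h1 hκ
    have h2' := mul_le_mul_of_nonneg_left h2 hρ
    push_cast at h1' h2'
    linarith
  have hen := energy_le_of_vanish (κ := κ) hκ hρ hγ e i hwv fun x hx ↦ by simp [hw0 x hx]
  have hK : 0 ≤ (κ * (n + 1) + ρ) * Fintype.card J := by positivity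
  set K := (κ * (n + 1) + ρ) * Fintype.card J
  have hm0 : 0 ≤ mass v := mass_nonneg v
  have hm0' : 0 ≤ m := mass_nonneg _
  have hKη : 0 ≤ K * η ^ 2 := by positivity
  have h5 : (l - topEnergy κ ρ γ e n) * m ≤ K * η ^ 2 * (2 * m + 2 * mass v) := by
    have := mul_le_mul_of_nonneg_left hUle hKη
    linarith
  have : m ≤ mass v := by
    by_contra! hlt
    nlinarith [mul_pos (sub_pos.2 hη) (hm0.trans_lt hlt)]
  linarith

theorem abs_pow_sub_pow_le_of_adjacent {r : ℝ} (hr : 1 ≤ r) {a b : ℕ} (h1 : a ≤ b + 1)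
    (h2 : b ≤ a + 1) :
    |r ^ a - r ^ b| ≤ (r - 1) * r ^ b := by
  have hb : 0 < r ^ b := by positivity
  rcases (by omega : a = b ∨ a = b + 1 ∨ b = a + 1) with rfl | rfl | rfl
  · simpa using mul_nonneg (sub_nonneg.2 hr) hb.le
  · rw [abs_of_nonneg (by rw [pow_succ]; nlinarith), pow_succ]
    linarith
  · have ha : 0 < r ^ a := by positivity
    rw [abs_of_nonpos (by rw [pow_succ]; nlinarith), pow_succ]
    nlinarith [mul_nonneg ha.le (sq_nonneg (r - 1))]

/-- Exponential decay of an eigenfunction in the position of each single particle. -/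
theorem summable_pow_mul_sq (hκ : 0 ≤ κ) (hρ : 0 ≤ ρ) (hγ : 0 ≤ γ) {l : ℝ}
    (hgap : topEnergy κ ρ γ e n < l) {v : (Fin (n + 1) → Z) → ℝ} (hv : SqSummable v)
    (hl : ∀ x, ham κ ρ γ e v x = l * v x) (N : Z → ℕ) (hN0 : N 0 = 0)
    (hN1 : ∀ j z, N (z + e j) ≤ N z + 1) (hN2 : ∀ j z, N z ≤ N (z + e j) + 1) :
    ∃ r : ℝ, 1 < r ∧ ∀ i, SqSummable fun x ↦ r ^ N (x i) * v x := by
  obtain ⟨η, hη0, hη⟩ : ∃ η : ℝ, 0 < η ∧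
      4 * ((κ * (n + 1) + ρ) * Fintype.card J) * η ^ 2 < l - topEnergy κ ρ γ e n := by
    have : Tendsto (fun η : ℝ ↦ 4 * ((κ * (n + 1) + ρ) * Fintype.card J) * η ^ 2) (𝓝[>] 0)
        (𝓝 (4 * ((κ * (n + 1) + ρ) * Fintype.card J) * 0 ^ 2)) :=
      ((continuous_const.mul (continuous_pow 2)).tendsto 0).mono_left nhdsWithin_le_nhds
    have h := (this.eventually_lt_const (u := l - topEnergy κ ρ γ e n)
      (by simpa using hgap)).and self_mem_nhdsWithin
    obtain ⟨η, h1, h2⟩ := h.exists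
    exact ⟨η, h2, h1⟩
  refine ⟨1 + η, by linarith, fun i ↦ ?_⟩
  set r := 1 + η with hr
  have hr1 : 1 ≤ r := by linarith
  have bound (M : ℕ) : SqSummable (fun x ↦ r ^ min (N (x i)) M * v x) ∧
      mass (fun x ↦ r ^ min (N (x i)) M * v x) ≤ 4 * mass v := by
    constructor
    · refine hv.of_abs_le (r ^ M) fun x ↦ ?_
      rw [abs_mul, abs_of_nonneg (by positivity)]
      gcongr
      exact min_le_right _ _
    have step (s : Fin (n + 1) → Z) (hs : s i = 0 ∨ ∃ j, s i = e j) (x : Fin (n + 1) → Z) :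
        min (N ((x + s) i)) M ≤ min (N (x i)) M + 1 ∧
          min (N (x i)) M ≤ min (N ((x + s) i)) M + 1 := by
      rw [Pi.add_apply]
      rcases hs with hs | ⟨j, hs⟩
      · simp [hs]
      · have := hN1 j (x i)
        have := hN2 j (x i)
        rw [hs]
        omega
    have hw1 (s : Fin (n + 1) → Z) (hs : s i = 0 ∨ ∃ j, s i = e j) (x : Fin (n + 1) → Z) :
        |(r ^ min (N ((x + s) i)) M - 1) - (r ^ min (N (x i)) M - 1)|
          ≤ η * (r ^ min (N (x i)) M - 1 + 1) := by
      have := abs_pow_sub_pow_le_of_adjacent hr1 (step s hs x).1 (step s hs x).2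
      simpa [hr] using this
    have hw2 (s : Fin (n + 1) → Z) (hs : s i = 0 ∨ ∃ j, s i = e j) (x : Fin (n + 1) → Z) :
        |(r ^ min (N ((x + s) i)) M - 1) - (r ^ min (N (x i)) M - 1)|
          ≤ η * (r ^ min (N ((x + s) i)) M - 1 + 1) := by
      have := abs_pow_sub_pow_le_of_adjacent hr1 (step s hs x).2 (step s hs x).1
      rw [abs_sub_comm]
      simpa [hr] using this
    have hsingle (k : Fin (n + 1)) (j : J) : (Pi.single k (e j) : Fin (n + 1) → Z) i = 0 ∨
        ∃ j', (Pi.single k (e j) : Fin (n + 1) → Z) i = e j' := by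
      by_cases h : i = k
      · subst h
        exact Or.inr ⟨j, by simp⟩
      · exact Or.inl (by simp [h])
    have := mass_weight_le (w := fun x ↦ r ^ min (N (x i)) M - 1) (M := r ^ M) hκ hρ hγ hη hv hl i
      (fun x ↦ sub_nonneg.2 (one_le_pow₀ hr1))
      (fun x ↦ (sub_le_self _ zero_le_one).trans (pow_le_pow_right₀ hr1 (min_le_right _ _)))
      (fun x hx ↦ by simp [hx, hN0])
      (fun k j ↦ hw1 _ (hsingle k j)) (fun k j ↦ hw2 _ (hsingle k j))
      (fun j ↦ hw1 _ (Or.inr ⟨j, rfl⟩)) (fun j ↦ hw2 _ (Or.inr ⟨j, rfl⟩))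
    simpa using this
  refine summable_of_sum_le (c := 4 * mass v) (fun _ ↦ sq_nonneg _) fun u ↦ ?_
  obtain ⟨hsum, hle⟩ := bound (u.sup fun x ↦ N (x i))
  refine le_trans ?_ ((hsum.sum_le_tsum u fun _ _ ↦ sq_nonneg _).trans hle)
  refine (Finset.sum_congr rfl fun x hx ↦ ?_).le
  rw [min_eq_left (Finset.le_sup (f := fun x ↦ N (x i)) hx)]

end Hamiltonian

theorem summable_pi_prod {α : Type*} {g : α → ℝ} (hg : Summable g) (hg0 : ∀ a, 0 ≤ g a) (n : ℕ) :
    Summable fun x : Fin n → α ↦ ∏ i, g (x i) := by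
  induction n with
  | zero => exact (hasSum_fintype _).summable
  | succ n ih =>
    rw [← (Fin.consEquiv fun _ ↦ α).summable_iff]
    convert hg.mul_of_nonneg ih hg0 fun x ↦ Finset.prod_nonneg fun i _ ↦ hg0 _ using 2 with y
    simp [Fin.prod_univ_succ, Fin.consEquiv]

theorem summable_pow_natAbs {t : ℝ} (h0 : 0 ≤ t) (h1 : t < 1) :
    Summable fun z : ℤ ↦ t ^ z.natAbs := by
  refine Summable.of_nat_of_neg ?_ ?_ <;> simpa using summable_geometric_of_lt_one h0 h1

/-- Square-summability with exponential weights in each variable implies summability. -/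
theorem summable_abs_of_sqSummable_pow_mul {Z : Type*} {n : ℕ} {N : Z → ℕ}
    (hN : ∀ t : ℝ, 0 ≤ t → t < 1 → Summable fun z ↦ t ^ N z) {v : (Fin (n + 1) → Z) → ℝ} {r : ℝ}
    (hr : 1 < r) (h : ∀ i, SqSummable fun x ↦ r ^ N (x i) * v x) : Summable fun x ↦ |v x| := by
  have hr0 : 0 < r := zero_lt_one.trans hr
  obtain ⟨t, ht0, ht⟩ : ∃ t : ℝ, 0 ≤ t ∧ t ^ (n + 1) = (r ^ 2)⁻¹ :=
    ⟨((r ^ 2)⁻¹) ^ ((n + 1 : ℕ) : ℝ)⁻¹, by positivity,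
      Real.rpow_inv_natCast_pow (by positivity) (by omega)⟩
  have ht1 : t < 1 := by
    refine (pow_lt_one_iff_of_nonneg ht0 n.succ_ne_zero).1 ?_
    rw [ht]
    exact inv_lt_one_of_one_lt₀ (one_lt_pow₀ hr two_ne_zero)
  refine Summable.of_nonneg_of_le (fun _ ↦ abs_nonneg _) (fun x ↦ ?_)
    ((summable_sum fun i (_ : i ∈ Finset.univ) ↦ h i).add
      (summable_pi_prod (hN t ht0 ht1) (fun _ ↦ by positivity) (n + 1)))
  obtain ⟨k, hk⟩ := Finite.exists_max fun i ↦ N (x i)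
  have h1 : (r ^ N (x k) * v x) ^ 2 ≤ ∑ i, (r ^ N (x i) * v x) ^ 2 :=
    Finset.single_le_sum (f := fun i ↦ (r ^ N (x i) * v x) ^ 2) (fun _ _ ↦ sq_nonneg _)
      (Finset.mem_univ k)
  have h2 : ((r ^ N (x k))⁻¹) ^ 2 ≤ ∏ i, t ^ N (x i) := by
    have : ((r ^ N (x k))⁻¹) ^ 2 = ∏ _i : Fin (n + 1), t ^ N (x k) := by
      rw [Finset.prod_const, Finset.card_univ, Fintype.card_fin, ← pow_mul, mul_comm, pow_mul, ht,
        inv_pow, inv_pow, ← pow_mul, ← pow_mul, mul_comm]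
    rw [this]
    exact Finset.prod_le_prod (fun _ _ ↦ by positivity) fun i _ ↦
      pow_le_pow_of_le_one ht0 ht1.le (hk i)
  have h3 : |v x| = |r ^ N (x k) * v x| * (r ^ N (x k))⁻¹ := by
    rw [abs_mul, abs_of_pos (by positivity : 0 < r ^ N (x k))]
    field_simp
  rw [h3]
  rw [← sq_abs] at h1
  nlinarith [sq_nonneg (|r ^ N (x k) * v x| - (r ^ N (x k))⁻¹),
    sq_nonneg (|r ^ N (x k) * v x|), sq_nonneg ((r ^ N (x k))⁻¹)]


theorem add_single_eq_update {ι Z : Type*} [DecidableEq ι] [AddCommGroup Z] (x : ι → Z) (i : ι)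
    (a : Z) : x + Pi.single i a = Function.update x i (x i + a) := by
  ext k
  by_cases h : k = i
  · subst h; simp
  · simp [h]

theorem sub_single_eq_update {ι Z : Type*} [DecidableEq ι] [AddCommGroup Z] (x : ι → Z) (i : ι)
    (a : Z) : x - Pi.single i a = Function.update x i (x i - a) := by
  rw [sub_eq_add_neg, ← Pi.single_neg, add_single_eq_update, sub_eq_add_neg]

/-- Suppose `λ_p := sup σ(H^p) > 0` (with `H^p = A^p + γV^p` the
`p`-th Anderson Hamiltonian on `ℓ²(ℤ^{pd})`) and `v_p ∈ ℓ²(ℤ^{pd})` is an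
eigenfunction with `H^p v_p = λ_p v_p`. Then `v_p ∈ ℓ¹(ℤ^{pd})`, i.e.
`Σ_x |v_p(x)| < ∞`. -/
theorem principal_eigenfunction_summable
    (d p : ℕ) (hd : 1 ≤ d) (hp : 1 ≤ p)
    (κ ρ γ : ℝ) (hκ : 0 < κ) (hρ : 0 < ρ) (hγ : 0 < γ)
    (Hp : lp (fun _ : Fin p → Fin d → ℤ => ℝ) 2 →L[ℝ] lp (fun _ : Fin p → Fin d → ℤ => ℝ) 2)
    (hHp : ∀ (f : lp (fun _ : Fin p → Fin d → ℤ => ℝ) 2) (x : Fin p → Fin d → ℤ),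
      Hp f x = κ * (∑ i : Fin p, ∑ j : Fin d,
          ((f (Function.update x i (x i + Pi.single j 1)) - f x)
            + (f (Function.update x i (x i - Pi.single j 1)) - f x)))
        + ρ * (∑ j : Fin d,
          ((f (fun i => x i + Pi.single j 1) - f x)
            + (f (fun i => x i - Pi.single j 1) - f x)))
        + γ * ((∑ i : Fin p, if x i = 0 then (1:ℝ) else 0) * f x))
    (hlam : 0 < sSup (spectrum ℝ Hp))
    (v : lp (fun _ : Fin p → Fin d → ℤ => ℝ) 2) (hv0 : v ≠ 0)
    (hv : Hp v = sSup (spectrum ℝ Hp) • v) :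
    Summable (fun x : Fin p → Fin d → ℤ => |v x|) := by
  obtain ⟨n, rfl⟩ : ∃ n, p = n + 1 := ⟨p - 1, by omega⟩
  set e : Fin d → Fin d → ℤ := fun j ↦ Pi.single j 1 with he
  set N : (Fin d → ℤ) → ℕ := fun z ↦ ∑ j, (z j).natAbs with hN
  have hham (f : lp (fun _ : Fin (n + 1) → Fin d → ℤ => ℝ) 2) (x : Fin (n + 1) → Fin d → ℤ) :
      Hp f x = ham κ ρ γ e f x := by
    rw [hHp]
    simp only [ham, secondDiff, add_single_eq_update x, sub_single_eq_update x]
    rfl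
  have hsq (f : lp (fun _ : Fin (n + 1) → Fin d → ℤ => ℝ) 2) : SqSummable f := by
    have := (memℓp_gen_iff (by norm_num)).1 (lp.memℓp f)
    simpa [SqSummable] using this
  have hinner (f g : lp (fun _ : Fin (n + 1) → Fin d → ℤ => ℝ) 2) :
      inner ℝ (Hp f) g = hamForm κ ρ γ e g f := by
    rw [lp.inner_eq_tsum, ← (hasSum_mul_ham (hsq g) (hsq f)).tsum_eq]
    simp [hham]
  have hsymm (f g : lp (fun _ : Fin (n + 1) → Fin d → ℤ => ℝ) 2) :
      inner ℝ (Hp f) g = inner ℝ f (Hp g) := by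
    rw [real_inner_comm (Hp g), hinner, hinner, hamForm_comm]
  have hbound : IsEnergyBound κ ρ γ e (n + 1) (sSup (spectrum ℝ Hp)) := by
    intro f hf
    have hmem : Memℓp f 2 := (memℓp_gen_iff (by norm_num)).2 (by simpa [SqSummable] using hf)
    have h := inner_apply_self_le_sSup_spectrum Hp hsymm ⟨f, hmem⟩
    rw [hinner, ← real_inner_self_eq_norm_sq, lp.inner_eq_tsum] at h
    rw [← hamForm_self]
    simpa [mass, sq] using h
  have hgap : topEnergy κ ρ γ e n < sSup (spectrum ℝ Hp) := by
    have h1 := mul_topEnergy_le hκ.le hρ.le hγ.le e n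
    have h2 := mul_le_mul_of_nonneg_left hbound.topEnergy_le (Nat.cast_nonneg (α := ℝ) n)
    by_contra! h3
    have h4 := mul_le_mul_of_nonneg_left h3 (by positivity : (0 : ℝ) ≤ n + 1)
    linarith
  have heig (x : Fin (n + 1) → Fin d → ℤ) : ham κ ρ γ e v x = sSup (spectrum ℝ Hp) * v x := by
    rw [← hham, hv]
    rfl
  have hstep (j : Fin d) (z : Fin d → ℤ) : N (z + e j) ≤ N z + 1 ∧ N z ≤ N (z + e j) + 1 := by
    simp only [hN, he]
    rw [Fintype.sum_eq_add_sum_compl j, Fintype.sum_eq_add_sum_compl j]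
    have : ∑ k ∈ {j}ᶜ, ((z + Pi.single j 1 : Fin d → ℤ) k).natAbs = ∑ k ∈ {j}ᶜ, (z k).natAbs :=
      Finset.sum_congr rfl fun k hk ↦ by
        rw [Pi.add_apply, Pi.single_eq_of_ne (by simpa using hk), add_zero]
    rw [this, Pi.add_apply, Pi.single_eq_same]
    omega
  obtain ⟨r, hr, hdecay⟩ := summable_pow_mul_sq hκ.le hρ.le hγ.le hgap (hsq v) heig N
    (by simp [hN]) (fun j z ↦ (hstep j z).1) fun j z ↦ (hstep j z).2
  refine summable_abs_of_sqSummable_pow_mul (fun t h0 h1 ↦ ?_) hr hdecay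
  simp only [hN, ← Finset.prod_pow_eq_pow_sum]
  exact summable_pi_prod (summable_pow_natAbs h0 h1) (fun _ ↦ by positivity) d
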